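/- Let f : [0,∞) → [0,∞) be continuous and nondecreasing with f(σ) > 0 for all σ > 0 and ∫_{z₀}^∞ dσ/f(σ) < ∞ for all z₀ > 0, and let h : [0,∞) → [0,∞) be continuous. Let s > 0 and let Ψ : [0,s] → ℝ be absolutely continuous with Ψ(0) > 0 and Ψ'(t) ≥ h(t) f(Ψ(t)) for almost every t ∈ [0,s]. Then ∫_0^s h(t) dt ≤ ∫_{Ψ(0)}^∞ dσ/f(σ). -/

import Mathlib

open MeasureTheory Real Set
open scoped ENNReal NNReal

/-- A primitive of `ψ` which starts at a positive value is nondecreasing as soon as `ψ` is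
almost everywhere nonnegative where the primitive is positive. -/
theorem monotoneOn_primitive_of_ae_nonneg_of_pos {Ψ ψ : ℝ → ℝ} {a b : ℝ} (hab : a ≤ b)
    (hψ : IntervalIntegrable ψ volume a b)
    (hΨ : ∀ t ∈ Icc a b, Ψ t = Ψ a + ∫ r in a..t, ψ r) (ha : 0 < Ψ a)
    (hnonneg : ∀ᵐ t, t ∈ Icc a b → 0 < Ψ t → 0 ≤ ψ t) :
    MonotoneOn Ψ (Icc a b) := by
  have hcont : ContinuousOn Ψ (Icc a b) := by
    have hprim := intervalIntegral.continuousOn_primitive_interval' hψ left_mem_uIcc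
    rw [uIcc_of_le hab] at hprim
    exact (continuousOn_const.add hprim).congr hΨ
  have hmono {x y : ℝ} (hx : x ∈ Icc a b) (hy : y ∈ Icc a b) (hxy : x ≤ y)
      (hpos : ∀ t ∈ Icc x y, 0 < Ψ t) : Ψ x ≤ Ψ y := by
    have hadd : (∫ r in a..x, ψ r) + ∫ r in x..y, ψ r = ∫ r in a..y, ψ r :=
      intervalIntegral.integral_add_adjacent_intervals
        (hψ.mono_set (uIcc_subset_uIcc left_mem_uIcc (uIcc_of_le hab ▸ hx)))
        (hψ.mono_set (uIcc_subset_uIcc (uIcc_of_le hab ▸ hx) (uIcc_of_le hab ▸ hy)))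
    have hint : 0 ≤ ∫ r in x..y, ψ r := by
      refine intervalIntegral.integral_nonneg_of_ae_restrict hxy ?_
      refine (ae_restrict_iff' measurableSet_Icc).2 ?_
      filter_upwards [hnonneg] with t ht htxy
      exact ht ⟨hx.1.trans htxy.1, htxy.2.trans hy.2⟩ (hpos t htxy)
    rw [hΨ x hx, hΨ y hy]
    linarith
  have hge : Icc a b ⊆ {t | Ψ a ≤ Ψ t} := by
    refine IsClosed.Icc_subset_of_forall_exists_gt ?_ (le_refl (Ψ a)) ?_
    · rw [inter_comm]
      exact hcont.preimage_isClosed_of_isClosed isClosed_Icc isClosed_Ici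
    · rintro x ⟨hxa, hx⟩ y hxy
      have hev : ∀ᶠ t in nhdsWithin x (Icc a b), 0 < Ψ t :=
        (hcont x (Ico_subset_Icc_self hx)).eventually (lt_mem_nhds (ha.trans_le hxa))
      obtain ⟨δ, hδ, hball⟩ := Metric.mem_nhdsWithin_iff.1 hev
      obtain ⟨z, hxz, hz⟩ := exists_between (lt_min (lt_min hxy hx.2) (lt_add_of_pos_right x hδ))
      simp only [lt_min_iff] at hz
      have hzI : z ∈ Icc a b := ⟨hx.1.trans hxz.le, hz.1.2.le⟩
      refine ⟨z, le_trans hxa (hmono (Ico_subset_Icc_self hx) hzI hxz.le fun t ht => ?_),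
        hxz, hz.1.1.le⟩
      refine hball ⟨?_, hx.1.trans ht.1, ht.2.trans hzI.2⟩
      rw [Metric.mem_ball, Real.dist_eq, abs_of_nonneg (sub_nonneg.2 ht.1)]
      linarith [ht.2]
  exact fun x hx y hy hxy => hmono hx hy hxy fun t ht =>
    ha.trans_le (hge ⟨hx.1.trans ht.1, ht.2.trans hy.2⟩)

/-- A primitive of `ψ` has derivative `ψ` almost everywhere. -/
theorem ae_hasDerivAt_of_eq_add_integral {Ψ ψ : ℝ → ℝ} {a b : ℝ} (hab : a ≤ b)
    (hψ : IntervalIntegrable ψ volume a b)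
    (hΨ : ∀ t ∈ Icc a b, Ψ t = Ψ a + ∫ r in a..t, ψ r) :
    ∀ᵐ t, t ∈ Ioo a b → HasDerivAt Ψ (ψ t) t := by
  filter_upwards [hψ.ae_hasDerivAt_integral] with t ht hmem
  rw [uIcc_of_le hab] at ht
  refine ((ht (Ioo_subset_Icc_self hmem) a (left_mem_Icc.2 hab)).const_add
    (Ψ a)).congr_of_eventuallyEq ?_
  filter_upwards [Icc_mem_nhds hmem.1 hmem.2] with r hr using hΨ r hr

/-- **Osgood-type differential inequality estimate.**
Let `f : [0,∞) → [0,∞)` be continuous, nondecreasing, positive on `(0,∞)` with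
`∫_{z₀}^∞ dσ/f(σ) < ∞` for every `z₀ > 0`, and `h : [0,∞) → [0,∞)` continuous.
If `Ψ : [0,s] → ℝ` is absolutely continuous (encoded by the fundamental theorem
of calculus with an integrable a.e.-derivative `Ψ'`), `Ψ(0) > 0`, and
`Ψ'(t) ≥ h(t) f(Ψ(t))` for a.e. `t ∈ [0,s]`, then
`∫_0^s h(t) dt ≤ ∫_{Ψ(0)}^∞ dσ/f(σ)`. -/
theorem osgood_inequality (f h : ℝ → ℝ)
    (hf_cont : ContinuousOn f (Set.Ici 0)) (hf_nonneg : ∀ z ∈ Set.Ici (0 : ℝ), 0 ≤ f z)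
    (hf_mono : MonotoneOn f (Set.Ici 0)) (hf_pos : ∀ σ > (0 : ℝ), 0 < f σ)
    (hOsgood : ∀ z₀ > (0 : ℝ), IntegrableOn (fun σ => 1 / f σ) (Set.Ioi z₀) volume)
    (hh_cont : ContinuousOn h (Set.Ici 0)) (hh_nonneg : ∀ t ∈ Set.Ici (0 : ℝ), 0 ≤ h t)
    (s : ℝ) (hs : 0 < s) (Ψ Ψ' : ℝ → ℝ)
    (hΨ'int : IntegrableOn Ψ' (Set.Icc 0 s) volume)
    (hΨ_ftc : ∀ t ∈ Set.Icc (0 : ℝ) s, Ψ t = Ψ 0 + ∫ r in Set.Ioc (0 : ℝ) t, Ψ' r)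
    (hΨ0 : 0 < Ψ 0)
    (hΨ'ineq : ∀ᵐ t ∂volume, t ∈ Set.Icc (0 : ℝ) s → h t * f (Ψ t) ≤ Ψ' t) :
    (∫ t in Set.Ioc (0 : ℝ) s, h t) ≤ ∫ σ in Set.Ioi (Ψ 0), 1 / f σ := by
  have hΨ'i : IntervalIntegrable Ψ' volume 0 s :=
    (intervalIntegrable_iff_integrableOn_Icc_of_le hs.le).2 hΨ'int
  have hΨ : ∀ t ∈ Icc 0 s, Ψ t = Ψ 0 + ∫ r in 0..t, Ψ' r := fun t ht => by
    rw [intervalIntegral.integral_of_le ht.1]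
    exact hΨ_ftc t ht
  have hΨmono : MonotoneOn Ψ (Icc 0 s) := by
    refine monotoneOn_primitive_of_ae_nonneg_of_pos hs.le hΨ'i hΨ hΨ0 ?_
    filter_upwards [hΨ'ineq] with t ht hmem hpos
    exact (mul_nonneg (hh_nonneg t hmem.1) (hf_nonneg _ hpos.le)).trans (ht hmem)
  have hΨge {t : ℝ} (ht : t ∈ Icc 0 s) : Ψ 0 ≤ Ψ t := hΨmono (left_mem_Icc.2 hs.le) ht ht.1
  -- Freezing `f` below `Ψ 0` makes the reciprocal continuous and positive on the whole line.
  set g : ℝ → ℝ := fun z => 1 / f (max z (Ψ 0)) with hg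
  have hmax (z : ℝ) : 0 < max z (Ψ 0) := lt_max_of_lt_right hΨ0
  have hgpos (z : ℝ) : 0 < g z := one_div_pos.2 (hf_pos _ (hmax z))
  have hgcont : Continuous g := by
    refine continuous_const.div ?_ fun z => (hf_pos _ (hmax z)).ne'
    exact hf_cont.comp_continuous (continuous_id.max continuous_const) fun z => (hmax z).le
  set F : ℝ → ℝ := fun z => ∫ σ in Ψ 0..z, g σ with hF
  have hFderiv (z : ℝ) : HasDerivAt F (g z) z := (hgcont.integral_hasStrictDerivAt _ z).hasDerivAt
  have hFmono : Monotone F := monotone_of_hasDerivAt_nonneg hFderiv fun z => (hgpos z).le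
  have hcomp : MonotoneOn (F ∘ Ψ) (uIcc 0 s) := by
    rw [uIcc_of_le hs.le]
    exact hFmono.comp_monotoneOn hΨmono
  have hderiv_ge : h ≤ᵐ[volume.restrict (Ioo 0 s)] deriv (F ∘ Ψ) := by
    refine (ae_restrict_iff' measurableSet_Ioo).2 ?_
    filter_upwards [hΨ'ineq, ae_hasDerivAt_of_eq_add_integral hs.le hΨ'i hΨ] with t hineq hd ht
    have htI := Ioo_subset_Icc_self ht
    rw [((hFderiv (Ψ t)).comp t (hd ht)).deriv, hg]
    simp only [max_eq_left (hΨge htI)]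
    rw [one_div_mul_eq_div, le_div_iff₀ (hf_pos _ (hΨ0.trans_le (hΨge htI)))]
    exact hineq htI
  have hhint : IntervalIntegrable h volume 0 s :=
    (hh_cont.mono (by rw [uIcc_of_le hs.le]; exact Icc_subset_Ici_self)).intervalIntegrable
  calc ∫ t in Ioc 0 s, h t = ∫ t in 0..s, h t := (intervalIntegral.integral_of_le hs.le).symm
    _ ≤ ∫ t in 0..s, deriv (F ∘ Ψ) t :=
      intervalIntegral.integral_mono_ae_restrict hs.le hhint hcomp.intervalIntegrable_deriv
        (by rwa [← restrict_Ioo_eq_restrict_Icc])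
    _ ≤ F (Ψ s) - F (Ψ 0) := by
      have hle : (F ∘ Ψ) 0 ≤ (F ∘ Ψ) s := hFmono (hΨge (right_mem_Icc.2 hs.le))
      have := hcomp.intervalIntegral_deriv_mem_uIcc
      rw [uIcc_of_le (sub_nonneg.2 hle)] at this
      exact this.2
    _ = ∫ σ in Ioc (Ψ 0) (Ψ s), 1 / f σ := by
      simp only [hF, intervalIntegral.integral_same, sub_zero]
      rw [intervalIntegral.integral_of_le (hΨge (right_mem_Icc.2 hs.le))]
      refine setIntegral_congr_fun measurableSet_Ioc fun σ hσ => ?_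
      simp only [hg, max_eq_left hσ.1.le]
    _ ≤ ∫ σ in Ioi (Ψ 0), 1 / f σ := by
      refine setIntegral_mono_set (hOsgood _ hΨ0) ?_ Ioc_subset_Ioi_self.eventuallyLE
      refine (ae_restrict_iff' measurableSet_Ioi).2 (.of_forall fun σ hσ => ?_)
      exact (one_div_pos.2 (hf_pos σ (hΨ0.trans hσ))).le
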